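/- For every integer r ≥ 3 there exists n₀ ∈ ℕ such that for all n ≥ n₀ the following holds. Let δ = 1/(34·log₂ n), let ξ be a real number with 0 < ξ ≤ 3/(5 + 8·log₂ r), and let A ⊆ [n] with |A| = (1 − ξ)n. If there exists a good r-template P of A with g(P, A) > 2^{(1−δ)n}, then ξ < (log₂ r − 1)·n^{−1/3}·log₂ n + δ and the number of integers x ∈ A with |P(x)| ≥ 3 is at most n^{2/3}·log₂ n. -/

import Mathlib

/-- A coloring `c : A → Fin r` is rainbow 3-AP-free if no 3-AP of `A`
receives three pairwise distinct colors. -/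
def RainbowAPFree {r : ℕ} (A : Finset ℕ) (c : A → Fin r) : Prop :=
  ∀ a d : ℕ, 0 < d → ∀ (h1 : a ∈ A) (h2 : a + d ∈ A) (h3 : a + 2 * d ∈ A),
    c ⟨a, h1⟩ = c ⟨a + d, h2⟩ ∨ c ⟨a + d, h2⟩ = c ⟨a + 2 * d, h3⟩ ∨
      c ⟨a, h1⟩ = c ⟨a + 2 * d, h3⟩

/-- `fAP n` is the number of 3-APs in `[n] = {1, …, n}`. -/
def fAP (n : ℕ) : ℕ :=
  (((Finset.Icc 1 n) ×ˢ (Finset.Icc 1 n)).filter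
    fun p => p.1 + p.2 ∈ Finset.Icc 1 n ∧ p.1 + 2 * p.2 ∈ Finset.Icc 1 n).card

/-- `Rtemp n P` is the number of pairs consisting of a 3-AP `(a, a+d, a+2d)` of
`[n]` together with pairwise distinct colors `i ∈ P a`, `j ∈ P (a+d)`,
`ℓ ∈ P (a+2d)`. -/
def Rtemp {r : ℕ} (n : ℕ) (P : ℕ → Finset (Fin r)) : ℕ :=
  ((((Finset.Icc 1 n) ×ˢ (Finset.Icc 1 n)) ×ˢ
      ((Finset.univ : Finset (Fin r)) ×ˢ Finset.univ ×ˢ Finset.univ)).filter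
    fun t => t.1.1 + 2 * t.1.2 ≤ n ∧ t.2.1 ∈ P t.1.1 ∧
      t.2.2.1 ∈ P (t.1.1 + t.1.2) ∧ t.2.2.2 ∈ P (t.1.1 + 2 * t.1.2) ∧
      t.2.1 ≠ t.2.2.1 ∧ t.2.2.1 ≠ t.2.2.2 ∧ t.2.1 ≠ t.2.2.2).card

/-- `P` is a good `r`-template of `A` (inside `[n]`) if every `x ∈ A` has a
nonempty palette and `R(P) ≤ n^{-1/3} · f(n)`. -/
def GoodTemplate {r : ℕ} (n : ℕ) (A : Finset ℕ) (P : ℕ → Finset (Fin r)) : Prop :=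
  (∀ x ∈ A, (P x).Nonempty) ∧
    (Rtemp n P : ℝ) ≤ (n : ℝ) ^ (-(1/3 : ℝ)) * fAP n

/-- `gPA A P` is the number of rainbow 3-AP-free `r`-colorings of `A` that are
subtemplates of `P`, i.e. with `c x ∈ P x` for every `x ∈ A`. -/
noncomputable def gPA {r : ℕ} (A : Finset ℕ) (P : ℕ → Finset (Fin r)) : ℕ :=
  Nat.card {c : A → Fin r // RainbowAPFree A c ∧
    ∀ (x : ℕ) (hx : x ∈ A), c ⟨x, hx⟩ ∈ P x}

open Finset

/-- `x ≠ y` and `x, y, z` form a 3-AP in some order. -/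
def AP3 (x y z : ℕ) : Prop := x ≠ y ∧ (2 * y = x + z ∨ 2 * x = y + z ∨ x + y = 2 * z)

lemma exists_rainbow {α : Type*} [DecidableEq α] (s t u : Finset α) (hs : 3 ≤ s.card)
    (ht : 2 ≤ t.card) (hu : u.Nonempty) :
    ∃ i ∈ s, ∃ j ∈ t, ∃ k ∈ u, i ≠ j ∧ i ≠ k ∧ j ≠ k := by
  obtain ⟨k, hk⟩ := hu
  obtain ⟨j, hj, hjk⟩ := Finset.exists_mem_ne (by omega : 1 < t.card) k
  have : (s \ {j, k}).Nonempty := by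
    rw [← Finset.card_pos]
    have h1 := Finset.le_card_sdiff {j, k} s
    have h2 : ({j, k} : Finset α).card ≤ 2 := Finset.card_le_two
    omega
  obtain ⟨i, hi⟩ := this
  simp only [mem_sdiff, mem_insert, mem_singleton, not_or] at hi
  exact ⟨i, hi.1, j, hj, k, hk, hi.2.1, hi.2.2, hjk⟩

open Classical in
lemma gPA_le {r : ℕ} (hr : 3 ≤ r) (A : Finset ℕ) (P : ℕ → Finset (Fin r))
    (hP : ∀ x ∈ A, (P x).Nonempty) :
    (gPA A P : ℝ) ≤ (2 : ℝ) ^ (((A.filter fun x => 2 ≤ (P x).card).card : ℝ)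
      + (Real.logb 2 r - 1) * ((A.filter fun x => 3 ≤ (P x).card).card : ℝ)) := by
  have h1 : gPA A P ≤ ∏ x ∈ A, (P x).card := by
    unfold gPA
    have : Function.Injective (fun c : {c : A → Fin r // RainbowAPFree A c ∧
        ∀ (x : ℕ) (hx : x ∈ A), c ⟨x, hx⟩ ∈ P x} =>
        (fun x : A => (⟨c.1 x, c.2.2 x.1 x.2⟩ : P x.1))) := by
      intro c d h
      apply Subtype.ext
      funext x
      have := congrFun h x
      simpa using this
    have h2 := Nat.card_le_card_of_injective _ this
    refine h2.trans (le_of_eq ?_)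
    rw [Nat.card_pi]
    simp only [Nat.card_eq_fintype_card, Fintype.card_coe]
    exact Finset.prod_coe_sort A (fun x => (P x).card)
  have hr0 : (0 : ℝ) < r := by positivity
  have h2 : ((∏ x ∈ A, (P x).card : ℕ) : ℝ) ≤ ∏ x ∈ A,
      (2 : ℝ) ^ ((if 2 ≤ (P x).card then (1:ℝ) else 0) +
        (Real.logb 2 r - 1) * (if 3 ≤ (P x).card then (1:ℝ) else 0)) := by
    push_cast
    apply Finset.prod_le_prod
    · intros; positivity
    · intro x hx
      have hc : (P x).card ≤ r := by simpa using Finset.card_le_univ (P x)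
      have hpos := (hP x hx).card_pos
      by_cases h3 : 3 ≤ (P x).card
      · have : 2 ≤ (P x).card := by omega
        simp only [h3, this, if_true, mul_one, add_sub_cancel]
        rw [Real.rpow_logb (by norm_num) (by norm_num) hr0]
        exact_mod_cast hc
      · by_cases h2 : 2 ≤ (P x).card
        · simp only [h3, h2, if_true, if_false, mul_zero, add_zero, Real.rpow_one]
          have : (P x).card ≤ 2 := by omega
          exact_mod_cast this
        · simp only [h3, h2, if_false, mul_zero, add_zero, Real.rpow_zero]
          have : (P x).card ≤ 1 := by omega
          exact_mod_cast this
  rw [← Real.rpow_sum_of_pos (by norm_num : (0:ℝ) < 2), Finset.sum_add_distrib, ← Finset.mul_sum,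
    Finset.sum_boole, Finset.sum_boole] at h2
  exact le_trans (by exact_mod_cast h1) h2

open Classical in
lemma pairs_le {r : ℕ} (n : ℕ) (A : Finset ℕ) (hA : A ⊆ Icc 1 n) (P : ℕ → Finset (Fin r))
    (hP : ∀ x ∈ A, (P x).Nonempty) :
    (((A.filter fun x => 3 ≤ (P x).card) ×ˢ (A.filter fun x => 2 ≤ (P x).card)).filter
      (fun p => ∃ z ∈ A, AP3 p.1 p.2 z)).card ≤ 6 * Rtemp n P := by
  set S : Finset (ℕ × ℕ) := ((Icc 1 n) ×ˢ (Icc 1 n)).filter (fun q => q.1 + 2 * q.2 ≤ n ∧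
    ∃ i ∈ P q.1, ∃ j ∈ P (q.1 + q.2), ∃ k ∈ P (q.1 + 2 * q.2), i ≠ j ∧ j ≠ k ∧ i ≠ k) with hS
  have hSR : S.card ≤ Rtemp n P := by
    unfold Rtemp
    refine le_trans (Finset.card_le_card ?_) (Finset.card_image_le (f := Prod.fst))
    intro q hq
    simp only [hS, mem_filter] at hq
    obtain ⟨hq1, hq2, i, hi, j, hj, k, hk, h⟩ := hq
    rw [Finset.mem_image]
    refine ⟨(q, (i, j, k)), ?_, rfl⟩
    simp only [mem_filter, mem_product, mem_univ, and_true] at hq1 ⊢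
    exact ⟨hq1, hq2, hi, hj, hk, h.1, h.2.1, h.2.2⟩
  refine le_trans ?_ (Nat.mul_le_mul_left 6 hSR)
  rw [mul_comm]
  refine le_trans (Finset.card_le_card ?_) (Finset.card_biUnion_le_card_mul S
    (fun q => {(q.1, q.1+q.2), (q.1, q.1+2*q.2), (q.1+q.2, q.1), (q.1+q.2, q.1+2*q.2),
      (q.1+2*q.2, q.1), (q.1+2*q.2, q.1+q.2)}) 6 (fun q _ => Finset.card_le_six))
  rintro ⟨x, y⟩ hxy
  simp only [mem_filter, mem_product] at hxy
  obtain ⟨⟨⟨hx, hx3⟩, hy, hy2⟩, z, hz, hne, hap⟩ := hxy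
  obtain ⟨i, hi, j, hj, k, hk, hij, hik, hjk⟩ :=
    exists_rainbow (P x) (P y) (P z) hx3 hy2 (hP z hz)
  have hx' := Finset.mem_Icc.1 (hA hx)
  have hy' := Finset.mem_Icc.1 (hA hy)
  have hz' := Finset.mem_Icc.1 (hA hz)
  have key : ∀ u v w : ℕ, 2 * v = u + w → u < v → (1 ≤ u ∧ w ≤ n) →
      (∃ i ∈ P u, ∃ j ∈ P v, ∃ k ∈ P w, i ≠ j ∧ j ≠ k ∧ i ≠ k) →
      (u, v - u) ∈ S ∧ v = u + (v - u) ∧ w = u + 2 * (v - u) := by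
    intro u v w h1 h2 h3 h4
    have e1 : u + (v - u) = v := by omega
    have e2 : u + 2 * (v - u) = w := by omega
    refine ⟨?_, e1.symm, e2.symm⟩
    simp only [hS, mem_filter, mem_product, mem_Icc, e1, e2]
    exact ⟨by omega, by omega, h4⟩
  rw [Finset.mem_biUnion]
  simp only [mem_insert, mem_singleton, Prod.mk.injEq]
  rcases hap with h | h | h
  · rcases lt_or_gt_of_ne hne with hl | hl
    · obtain ⟨a, b, c⟩ := key x y z h hl (by omega) ⟨i, hi, j, hj, k, hk, hij, hjk, hik⟩
      exact ⟨_, a, by grind⟩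
    · obtain ⟨a, b, c⟩ := key z y x (by omega) (by omega) (by omega)
        ⟨k, hk, j, hj, i, hi, hjk.symm, hij.symm, hik.symm⟩
      exact ⟨_, a, by grind⟩
  · rcases lt_or_gt_of_ne hne with hl | hl
    · obtain ⟨a, b, c⟩ := key z x y (by omega) (by omega) (by omega)
        ⟨k, hk, i, hi, j, hj, hik.symm, hij, hjk.symm⟩
      exact ⟨_, a, by grind⟩
    · obtain ⟨a, b, c⟩ := key y x z (by omega) (by omega) (by omega)
        ⟨j, hj, i, hi, k, hk, hij.symm, hik, hjk⟩
      exact ⟨_, a, by grind⟩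
  · rcases lt_or_gt_of_ne hne with hl | hl
    · obtain ⟨a, b, c⟩ := key x z y (by omega) (by omega) (by omega)
        ⟨i, hi, k, hk, j, hj, hik, hjk.symm, hij⟩
      exact ⟨_, a, by grind⟩
    · obtain ⟨a, b, c⟩ := key y z x (by omega) (by omega) (by omega)
        ⟨j, hj, k, hk, i, hi, hjk, hik.symm, hij.symm⟩
      exact ⟨_, a, by grind⟩

open Classical in
lemma B_le (n x : ℕ) (A B : Finset ℕ) (hB : B ⊆ Icc 1 n) (hx : x ∈ Icc 1 n) :
    B.card ≤ (B.filter fun y => ∃ z ∈ A, AP3 x y z).card + 3 * (Icc 1 n \ A).card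
      + (n / 2 - n / 4 + 2) := by
  set C := Icc 1 n \ A with hC
  set D := B.filter fun y => ∃ z ∈ A, AP3 x y z with hD
  have h1 : (B.filter fun y => ∃ z ∈ C, 2 * y = x + z).card ≤ C.card := by
    apply Finset.card_le_card_of_injOn (fun y => 2 * y - x)
    · intro y hy
      simp only [coe_filter, Set.mem_ofPred_eq] at hy
      obtain ⟨_, z, hz, h⟩ := hy
      have : 2 * y - x = z := by omega
      simpa [this] using hz
    · intro y hy y' hy' h
      simp only [coe_filter, Set.mem_ofPred_eq] at hy hy' h
      obtain ⟨_, z, hz, h⟩ := hy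
      obtain ⟨_, z', hz', h'⟩ := hy'
      omega
  have h2 : (B.filter fun y => ∃ z ∈ C, 2 * x = y + z).card ≤ C.card := by
    apply Finset.card_le_card_of_injOn (fun y => 2 * x - y)
    · intro y hy
      simp only [coe_filter, Set.mem_ofPred_eq] at hy
      obtain ⟨_, z, hz, h⟩ := hy
      have : 2 * x - y = z := by omega
      simpa [this] using hz
    · intro y hy y' hy' h
      simp only [coe_filter, Set.mem_ofPred_eq] at hy hy' h
      obtain ⟨_, z, hz, h⟩ := hy
      obtain ⟨_, z', hz', h'⟩ := hy'
      omega
  have h3 : (B.filter fun y => ∃ z ∈ C, x + y = 2 * z).card ≤ C.card := by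
    apply Finset.card_le_card_of_injOn (fun y => (x + y) / 2)
    · intro y hy
      simp only [coe_filter, Set.mem_ofPred_eq] at hy
      obtain ⟨_, z, hz, h⟩ := hy
      have : (x + y) / 2 = z := by omega
      simpa [this] using hz
    · intro y hy y' hy' h
      simp only [coe_filter, Set.mem_ofPred_eq] at hy hy' h
      obtain ⟨_, z, hz, h⟩ := hy
      obtain ⟨_, z', hz', h'⟩ := hy'
      omega
  set E := B.filter fun y => (x + y) % 2 = 1 ∧ (n < 2 * y - x ∨ 2 * y ≤ x) ∧
    (n < 2 * x - y ∨ 2 * x ≤ y) with hE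
  rw [mem_Icc] at hx
  have h4 : E.card ≤ n / 2 - n / 4 + 1 := by
    by_cases hc : 2 * x ≤ n + 1
    · have : E.card ≤ (Icc (n / 4) (n / 2)).card := by
        apply Finset.card_le_card_of_injOn (fun y => y / 2)
        · intro y hy
          simp only [hE, coe_filter, Set.mem_ofPred_eq] at hy
          have := mem_Icc.1 (hB hy.1)
          simp only [coe_Icc, Set.mem_Icc]
          omega
        · intro y hy y' hy' h
          simp only [hE, coe_filter, Set.mem_ofPred_eq] at hy hy' h
          omega
      rw [Nat.card_Icc] at this
      omega
    · have : E.card ≤ (Icc 0 (n / 4)).card := by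
        apply Finset.card_le_card_of_injOn (fun y => y / 2)
        · intro y hy
          simp only [hE, coe_filter, Set.mem_ofPred_eq] at hy
          have := mem_Icc.1 (hB hy.1)
          simp only [coe_Icc, Set.mem_Icc]
          omega
        · intro y hy y' hy' h
          simp only [hE, coe_filter, Set.mem_ofPred_eq] at hy hy' h
          omega
      rw [Nat.card_Icc] at this
      omega
  have hsub : B ⊆ D ∪ ((B.filter fun y => ∃ z ∈ C, 2 * y = x + z) ∪
      ((B.filter fun y => ∃ z ∈ C, 2 * x = y + z) ∪
      ((B.filter fun y => ∃ z ∈ C, x + y = 2 * z) ∪ (E ∪ {x})))) := by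
    intro y hy
    have hy' := mem_Icc.1 (hB hy)
    by_cases hxy : x = y
    · simp [hxy]
    have main : ∀ z, 1 ≤ z ∧ z ≤ n →
        (2 * y = x + z ∨ 2 * x = y + z ∨ x + y = 2 * z) → y ∈ D ∨
        ∃ z ∈ C, (2 * y = x + z ∨ 2 * x = y + z ∨ x + y = 2 * z) := by
      intro z hz h
      by_cases hzA : z ∈ A
      · left; exact mem_filter.2 ⟨hy, z, hzA, hxy, h⟩
      · right; exact ⟨z, by rw [hC, mem_sdiff, mem_Icc]; exact ⟨hz, hzA⟩, h⟩
    by_cases hyE : y ∈ E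
    · simp [hyE]
    have : y ∈ D ∨
        ∃ z ∈ C, (2 * y = x + z ∨ 2 * x = y + z ∨ x + y = 2 * z) := by
      have hyE' : ¬ ((x + y) % 2 = 1 ∧ (n < 2 * y - x ∨ 2 * y ≤ x) ∧
          (n < 2 * x - y ∨ 2 * x ≤ y)) := fun h => hyE (mem_filter.2 ⟨hy, h⟩)
      by_cases e1 : (x + y) % 2 = 1
      · by_cases e2 : (n < 2 * y - x ∨ 2 * y ≤ x)
        · have e3 : ¬ (n < 2 * x - y ∨ 2 * x ≤ y) := fun e3 => hyE' ⟨e1, e2, e3⟩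
          exact main (2 * x - y) (by omega) (by omega)
        · exact main (2 * y - x) (by omega) (by omega)
      · exact main ((x + y) / 2) (by omega) (by omega)
    simp only [mem_union, mem_filter]
    rcases this with h | ⟨z, hz, h | h | h⟩
    · exact Or.inl h
    · exact Or.inr (Or.inl ⟨hy, z, hz, h⟩)
    · exact Or.inr (Or.inr (Or.inl ⟨hy, z, hz, h⟩))
    · exact Or.inr (Or.inr (Or.inr (Or.inl ⟨hy, z, hz, h⟩)))
  have := Finset.card_le_card hsub
  have u1 := card_union_le D ((B.filter fun y => ∃ z ∈ C, 2 * y = x + z) ∪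
      ((B.filter fun y => ∃ z ∈ C, 2 * x = y + z) ∪
      ((B.filter fun y => ∃ z ∈ C, x + y = 2 * z) ∪ (E ∪ {x}))))
  have u2 := card_union_le (B.filter fun y => ∃ z ∈ C, 2 * y = x + z)
      ((B.filter fun y => ∃ z ∈ C, 2 * x = y + z) ∪
      ((B.filter fun y => ∃ z ∈ C, x + y = 2 * z) ∪ (E ∪ {x})))
  have u3 := card_union_le (B.filter fun y => ∃ z ∈ C, 2 * x = y + z)
      ((B.filter fun y => ∃ z ∈ C, x + y = 2 * z) ∪ (E ∪ {x}))
  have u4 := card_union_le (B.filter fun y => ∃ z ∈ C, x + y = 2 * z) (E ∪ {x})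
  have u5 := card_union_le E {x}
  rw [card_singleton] at u5
  omega

open Classical in
lemma G_le (n : ℕ) (A B G : Finset ℕ) (hG : G ⊆ B) (hB : B ⊆ Icc 1 n) (m : ℕ)
    (hm : ∀ x ∈ G, (B.filter fun y => ∃ z ∈ A, AP3 x y z).card ≤ m) :
    G.card ≤ 2 * m + 2 * (Icc 1 n \ A).card + 2 := by
  rcases G.eq_empty_or_nonempty with rfl | hne
  · simp
  set C := Icc 1 n \ A with hC
  set x := G.min' hne with hx
  set w := G.max' hne with hw
  have hxG : x ∈ G := G.min'_mem hne
  have hwG : w ∈ G := G.max'_mem hne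
  have h1 : ∀ x : ℕ, (B.filter fun y => ∃ z ∈ C, 2 * y = x + z).card ≤ C.card := by
    intro x
    apply Finset.card_le_card_of_injOn (fun y => 2 * y - x)
    · intro y hy
      simp only [coe_filter, Set.mem_ofPred_eq] at hy
      obtain ⟨_, z, hz, h⟩ := hy
      have : 2 * y - x = z := by omega
      simpa [this] using hz
    · intro y hy y' hy' h
      simp only [coe_filter, Set.mem_ofPred_eq] at hy hy' h
      obtain ⟨_, z, hz, h⟩ := hy
      obtain ⟨_, z', hz', h'⟩ := hy'
      omega
  set D : ℕ → Finset ℕ := fun x => B.filter fun y => ∃ z ∈ A, AP3 x y z with hD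
  set F : ℕ → Finset ℕ := fun x => B.filter fun y => ∃ z ∈ C, 2 * y = x + z with hF
  have hsub : G ⊆ D x ∪ (D w ∪ (F x ∪ (F w ∪ {x, w}))) := by
    intro y hy
    have hxy : x ≤ y := G.min'_le y hy
    have hyw : y ≤ w := G.le_max' y hy
    have hx' := mem_Icc.1 (hB (hG hxG))
    have hw' := mem_Icc.1 (hB (hG hwG))
    by_cases e1 : y = x
    · simp [e1]
    by_cases e2 : y = w
    · simp [e2]
    have main : ∀ u z, u ≠ y → 1 ≤ z ∧ z ≤ n → 2 * y = u + z → y ∈ D u ∨ y ∈ F u := by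
      intro u z hu hz h
      by_cases hzA : z ∈ A
      · left; exact mem_filter.2 ⟨hG hy, z, hzA, hu, Or.inl h⟩
      · right
        exact mem_filter.2 ⟨hG hy, z, by rw [hC, mem_sdiff, mem_Icc]; exact ⟨hz, hzA⟩, h⟩
    simp only [mem_union]
    by_cases e3 : 2 * y ≤ x + w
    · have := main x (2 * y - x) (Ne.symm e1) (by omega) (by omega)
      tauto
    · have := main w (2 * y - w) (Ne.symm e2) (by omega) (by omega)
      tauto
  have := card_le_card hsub
  have u1 := card_union_le (D x) (D w ∪ (F x ∪ (F w ∪ {x, w})))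
  have u2 := card_union_le (D w) (F x ∪ (F w ∪ {x, w}))
  have u3 := card_union_le (F x) (F w ∪ {x, w})
  have u4 := card_union_le (F w) {x, w}
  have u5 : ({x, w} : Finset ℕ).card ≤ 2 := card_le_two
  have := h1 x
  have := h1 w
  have := hm x hxG
  have := hm w hwG
  simp only [hD, hF] at *
  omega

lemma fAP_le (n : ℕ) : fAP n ≤ n * n := by
  unfold fAP
  refine (card_filter_le _ _).trans ?_
  simp

lemma eventually_bound (L K s : ℝ) (hs : 0 < s) :
    ∃ n₀ : ℕ, ∀ n : ℕ, n₀ ≤ n → 2 ≤ n ∧ K < Real.logb 2 n ∧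
      (2 * L + 1) * (n : ℝ)⁻¹ + (L - 1) * K * (n : ℝ) ^ (-(1/3 : ℝ))
        + 1 / (34 * Real.logb 2 n) < s := by
  have hlog : Filter.Tendsto (fun n : ℕ => Real.logb 2 n) Filter.atTop Filter.atTop :=
    (Real.tendsto_logb_atTop (by norm_num)).comp tendsto_natCast_atTop_atTop
  have h1 : Filter.Tendsto (fun n : ℕ => (n : ℝ)⁻¹) Filter.atTop (nhds 0) :=
    tendsto_inv_atTop_nhds_zero_nat
  have h2 : Filter.Tendsto (fun n : ℕ => (n : ℝ) ^ (-(1/3 : ℝ))) Filter.atTop (nhds 0) :=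
    (tendsto_rpow_neg_atTop (by norm_num : (0:ℝ) < 1/3)).comp tendsto_natCast_atTop_atTop
  have h3 : Filter.Tendsto (fun n : ℕ => 1 / (34 * Real.logb 2 n)) Filter.atTop (nhds 0) := by
    simp only [one_div]
    exact (hlog.const_mul_atTop (by norm_num : (0:ℝ) < 34)).inv_tendsto_atTop
  have h4 := ((h1.const_mul (2 * L + 1)).add (h2.const_mul ((L - 1) * K))).add h3
  simp only [mul_zero, add_zero] at h4
  have h5 := (Filter.eventually_ge_atTop 2).and ((hlog.eventually_gt_atTop K).and
    (h4.eventually_lt_const hs))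
  exact Filter.eventually_atTop.1 h5

set_option maxHeartbeats 1000000 in
theorem stmt_11 (r : ℕ) (hr : 3 ≤ r) :
    ∃ n₀ : ℕ, ∀ n : ℕ, n₀ ≤ n → ∀ δ ξ : ℝ, δ = 1 / (34 * Real.logb 2 n) →
      0 < ξ → ξ ≤ 3 / (5 + 8 * Real.logb 2 r) →
      ∀ A : Finset ℕ, A ⊆ Finset.Icc 1 n → (A.card : ℝ) = (1 - ξ) * n →
      ∀ P : ℕ → Finset (Fin r), GoodTemplate n A P →
        (2 : ℝ) ^ ((1 - δ) * n) < (gPA A P : ℝ) →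
        ξ < (Real.logb 2 r - 1) * (n : ℝ) ^ (-(1/3 : ℝ)) * Real.logb 2 n + δ ∧
          ((A.filter fun x => 3 ≤ (P x).card).card : ℝ) ≤
            (n : ℝ) ^ ((2 : ℝ) / 3) * Real.logb 2 n := by
  classical
  have hL1 : 1 < Real.logb 2 r := by
    rw [Real.lt_logb_iff_rpow_lt (by norm_num) (by positivity)]
    have : (3:ℝ) ≤ r := by exact_mod_cast hr
    norm_num
    linarith
  set L := Real.logb 2 r with hL
  set s : ℝ := 3 / 4 / (5 + 8 * L) with hs
  have hs0 : 0 < s := by positivity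
  set ε : ℝ := s / (4 * L) with hε
  have hε0 : 0 < ε := by positivity
  obtain ⟨n₀, hn₀⟩ := eventually_bound L (6 / ε) (s / 2) (by positivity)
  refine ⟨n₀, ?_⟩
  intro n hn δ ξ hδ hξ0 hξ A hA hcard P hgood hg
  obtain ⟨hn2, hK, hbound⟩ := hn₀ n hn
  rw [← hδ] at hbound
  have hnpos : (0:ℝ) < n := by positivity
  have hup := gPA_le hr A P hgood.1
  have hlt := (Real.rpow_lt_rpow_left_iff (by norm_num : (1:ℝ) < 2)).1 (hg.trans_le hup)
  rw [← hL] at hlt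
  set X := A.filter fun x => 3 ≤ (P x).card with hX
  set B := A.filter fun x => 2 ≤ (P x).card with hBdef
  set C := Icc 1 n \ A with hC
  set t : ℝ := (n : ℝ) ^ (-(1/3 : ℝ)) with ht
  have ht0 : 0 < t := by positivity
  have hnt : (n : ℝ) ^ ((2:ℝ)/3) = n * t := by
    rw [ht, show ((2:ℝ)/3) = 1 + (-(1/3)) by norm_num, Real.rpow_add hnpos, Real.rpow_one]
  have hBA : B ⊆ A := filter_subset _ _
  have hXB : X ⊆ B := by
    intro x hx
    simp only [hX, hBdef, mem_filter] at hx ⊢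
    exact ⟨hx.1, by omega⟩
  have hBn : B ⊆ Icc 1 n := hBA.trans hA
  have hCcard : (C.card : ℝ) = ξ * n := by
    have h := Finset.card_sdiff_add_card_eq_card hA
    rw [Nat.card_Icc, ← hC] at h
    have h' : (C.card : ℝ) + A.card = n := by
      have : C.card + A.card = n := by omega
      exact_mod_cast this
    rw [hcard] at h'
    linarith
  have second : (X.card : ℝ) ≤ (n : ℝ) ^ ((2 : ℝ) / 3) * Real.logb 2 n := by
    by_contra hcon
    push Not at hcon
    rw [hnt] at hcon
    set D : ℕ → Finset ℕ := fun x => B.filter fun y => ∃ z ∈ A, AP3 x y z with hD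
    set G := X.filter fun x => ((D x).card : ℝ) ≤ ε * n with hG
    set N := X.filter fun x => ¬ ((D x).card : ℝ) ≤ ε * n with hN
    have hGN : (G.card : ℝ) + N.card = X.card := by
      exact_mod_cast Finset.card_filter_add_card_filter_not (s := X) (fun x => ((D x).card : ℝ) ≤ ε * n)
    have hpairs := pairs_le n A hA P hgood.1
    rw [← hX, ← hBdef] at hpairs
    have hsum : ∑ x ∈ X, (D x).card = ((X ×ˢ B).filter (fun p => ∃ z ∈ A, AP3 p.1 p.2 z)).card := by
      simp only [hD, Finset.card_filter, Finset.sum_product]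
    have hNle : (N.card : ℝ) * (ε * n) ≤ 6 * (t * (n * n)) := by
      calc (N.card : ℝ) * (ε * n) = ∑ x ∈ N, ε * n := by simp
        _ ≤ ∑ x ∈ N, ((D x).card : ℝ) := by
            apply Finset.sum_le_sum
            intro x hx
            exact (not_le.1 (mem_filter.1 hx).2).le
        _ ≤ ∑ x ∈ X, ((D x).card : ℝ) :=
            Finset.sum_le_sum_of_subset_of_nonneg (filter_subset _ _) (by intros; positivity)
        _ ≤ 6 * (Rtemp n P : ℝ) := by
            rw [← hsum] at hpairs
            exact_mod_cast hpairs
        _ ≤ 6 * (t * (n * n)) := by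
            have h1 := hgood.2
            have h2 : (fAP n : ℝ) ≤ n * n := by exact_mod_cast fAP_le n
            have h3 := mul_le_mul_of_nonneg_left h2 ht0.le
            linarith
    have hN2 : (N.card : ℝ) ≤ 6 / ε * (n * t) := by
      have : (N.card : ℝ) * (ε * n) ≤ (6 / ε * (n * t)) * (ε * n) := by
        refine hNle.trans (le_of_eq ?_)
        field_simp
      exact le_of_mul_le_mul_right this (by positivity)
    have hNX : (N.card : ℝ) < X.card := by
      refine lt_of_le_of_lt hN2 (lt_trans ?_ hcon)
      rw [mul_comm]
      exact mul_lt_mul_of_pos_left hK (by positivity)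
    have hGpos : 0 < G.card := by
      have : (0:ℝ) < G.card := by linarith
      exact_mod_cast this
    obtain ⟨x, hx⟩ := Finset.card_pos.1 hGpos
    have hxX : x ∈ X := (mem_filter.1 hx).1
    have hDx : ((D x).card : ℝ) ≤ ε * n := (mem_filter.1 hx).2
    have hB1 : (B.card : ℝ) ≤ ε * n + 3 * (ξ * n) + (n / 4 + 3) := by
      have h := B_le n x A B hBn (hBn (hXB hxX))
      have h4 : 4 * B.card ≤ 4 * (D x).card + 12 * C.card + n + 12 := by
        have h5 : B.card ≤ (D x).card + 3 * C.card + (n / 2 - n / 4 + 2) := h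
        omega
      have h6 : 4 * (B.card : ℝ) ≤ 4 * (D x).card + 12 * C.card + n + 12 := by exact_mod_cast h4
      rw [hCcard] at h6
      linarith
    have hG1 : (G.card : ℝ) ≤ 2 * (ε * n) + 2 * (ξ * n) + 2 := by
      have h := G_le n A B G ((filter_subset _ _).trans hXB) hBn ⌊ε * n⌋₊ (by
        intro y hy
        exact Nat.le_floor (mem_filter.1 hy).2)
      have h6 : (G.card : ℝ) ≤ 2 * (⌊ε * n⌋₊ : ℝ) + 2 * C.card + 2 := by exact_mod_cast h
      have := Nat.floor_le (by positivity : 0 ≤ ε * n)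
      rw [hCcard] at h6
      linarith
    have hX1 : (X.card : ℝ) ≤ 2 * (ε * n) + 2 * (ξ * n) + 2 + 6 / ε * (n * t) := by linarith
    have hX2 := mul_le_mul_of_nonneg_left hX1 (by linarith : 0 ≤ L - 1)
    have hmain : (1 - δ) * n < ε * n + 3 * (ξ * n) + (n / 4 + 3) +
      (L - 1) * (2 * (ε * n) + 2 * (ξ * n) + 2 + 6 / ε * (n * t)) := by linarith
    have hbn := mul_lt_mul_of_pos_right hbound hnpos
    have hinv : (n : ℝ)⁻¹ * n = 1 := inv_mul_cancel₀ hnpos.ne'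
    have hbn' : (2 * L + 1) + (L - 1) * (6 / ε) * t * n + δ * n < s / 2 * n := by
      have e : ((2 * L + 1) * (n : ℝ)⁻¹ + (L - 1) * (6 / ε) * t + δ) * n =
        (2 * L + 1) * ((n : ℝ)⁻¹ * n) + (L - 1) * (6 / ε) * t * n + δ * n := by ring
      rw [e, hinv] at hbn
      linarith
    have hεL : ε * (2 * L - 1) ≤ s / 2 := by
      have : ε * (4 * L) = s := by rw [hε]; field_simp
      linarith
    have hξs : ξ * (1 + 2 * L) ≤ 3 / 4 - s := by
      have e : 3 / (5 + 8 * L) * (1 + 2 * L) = 3 / 4 - s := by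
        rw [hs]; field_simp; ring
      rw [← e]
      exact mul_le_mul_of_nonneg_right hξ (by linarith)
    have q1 := mul_le_mul_of_nonneg_right hεL hnpos.le
    have q2 := mul_le_mul_of_nonneg_right hξs hnpos.le
    linarith
  refine ⟨?_, second⟩
  rw [hnt] at second
  have hBc : (B.card : ℝ) ≤ (1 - ξ) * n := by
    rw [← hcard]; exact_mod_cast card_le_card hBA
  have hX2 := mul_le_mul_of_nonneg_left second (by linarith : 0 ≤ L - 1)
  have : ξ * n < ((L - 1) * t * Real.logb 2 n + δ) * n := by linarith
  exact lt_of_mul_lt_mul_right this hnpos.le
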